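/- arXiv:1808.00951 — 2 statements merged into one kernel-verified Lean document; each statement's English description precedes it below -/
import Mathlib

section
/- Let G be an r-regular finite simple graph on n vertices with r ≡ 2 (mod 4) and n ≡ 2 (mod 4), let a ∈ {1, ..., n}, and suppose there is a bijection f : V(G) → {1, ..., n+1} \ {a} such that the weight w(u) = Σ_{v ∈ N(u)} f(v) is the same constant for every vertex u. Then a is even, a ≠ 2, and a ≠ n. -/
lemma even_double_count {V : Type*} [Fintype V] [DecidableEq V]
    (G : SimpleGraph V) [DecidableRel G.Adj] (f : V → ℕ) :
    Even (∑ u, f u * ∑ v ∈ G.neighborFinset u, f v) := by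
  rw [← ZMod.natCast_eq_zero_iff_even]
  have h1 : ∑ u, f u * ∑ v ∈ G.neighborFinset u, f v
      = ∑ p : V × V, if G.Adj p.1 p.2 then f p.1 * f p.2 else 0 := by
    rw [Fintype.sum_prod_type]
    refine Finset.sum_congr rfl fun u _ => ?_
    rw [Finset.mul_sum, ← Finset.sum_filter]
    refine Finset.sum_congr ?_ fun _ _ => rfl
    ext v; simp
  rw [h1]
  push_cast
  refine Finset.sum_involution (fun p _ => p.swap) ?_ ?_ ?_ ?_
  · rintro ⟨u, v⟩ _
    simp only [Prod.swap, G.adj_comm v u, mul_comm (f v : ZMod 2)]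
    exact CharTwo.add_self_eq_zero _
  · rintro ⟨u, v⟩ _ hne he
    simp only [Prod.swap, Prod.mk.injEq] at he
    obtain ⟨rfl, _⟩ := he
    simp at hne
  · intros; simp
  · intros; simp

/-- Let `G` be an `r`-regular finite simple graph on `n` vertices with
`r ≡ 2 (mod 4)` and `n ≡ 2 (mod 4)`, let `a ∈ {1,...,n}`, and suppose there is a bijection
`f : V(G) → {1,...,n+1} \ {a}` whose weight `w(u) = ∑_{v ∈ N(u)} f v` is the same constant
for every vertex `u`. Then `a` is even, `a ≠ 2`, and `a ≠ n`. -/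
theorem stmt2 {V : Type*} [Fintype V] [DecidableEq V]
    (G : SimpleGraph V) [DecidableRel G.Adj] (r a : ℕ)
    (hr : r % 4 = 2) (hn : Fintype.card V % 4 = 2)
    (hreg : G.IsRegularOfDegree r)
    (ha : a ∈ Finset.Icc 1 (Fintype.card V))
    (h : ∃ (f : V → ℕ) (c : ℕ),
        Set.BijOn f Set.univ ((Set.Icc 1 (Fintype.card V + 1)) \ {a}) ∧
        ∀ u : V, ∑ v ∈ G.neighborFinset u, f v = c) :
    Even a ∧ a ≠ 2 ∧ a ≠ Fintype.card V := by
  obtain ⟨f, c, hf, hc⟩ := h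
  have hev := even_double_count G f
  simp only [hc] at hev
  rw [← Finset.sum_mul] at hev
  -- total weight
  have hrS : r * ∑ v, f v = Fintype.card V * c := by
    have h1 : ∑ u, ∑ v ∈ G.neighborFinset u, f v = Fintype.card V * c := by
      simp [hc]
    rw [← h1, Finset.sum_comm' (t' := Finset.univ) (s' := fun v => G.neighborFinset v)
      (by intro x y; simp [G.adj_comm]), Finset.mul_sum]
    refine Finset.sum_congr rfl fun v _ => ?_
    simp [hreg v]
  -- sum of labels
  have hsum : ∑ v, f v + a = ∑ i ∈ Finset.Icc 1 (Fintype.card V + 1), i := by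
    have h2 : Finset.image f Finset.univ = (Finset.Icc 1 (Fintype.card V + 1)).erase a := by
      ext i
      have := Set.ext_iff.1 hf.image_eq i
      simp only [Set.image_univ, Set.mem_range, Set.mem_sdiff, Set.mem_Icc,
        Set.mem_singleton_iff] at this
      simp only [Finset.mem_image, Finset.mem_univ, true_and, Finset.mem_erase, Finset.mem_Icc]
      tauto
    have h3 : ∑ v, f v = ∑ i ∈ Finset.image f Finset.univ, i := by
      rw [Finset.sum_image]
      intro x _ y _ hxy
      exact hf.injOn (Set.mem_univ x) (Set.mem_univ y) hxy
    rw [h3, h2]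
    refine Finset.sum_erase_add _ _ ?_
    simp only [Finset.mem_Icc] at ha ⊢
    omega
  have hgauss : ∀ m : ℕ, 2 * ∑ i ∈ Finset.Icc 1 m, i = m * (m + 1) := by
    intro m
    induction m with
    | zero => simp
    | succ k ih => rw [Finset.sum_Icc_succ_top (by omega), mul_add, ih]; ring
  have hg := hgauss (Fintype.card V + 1)
  rw [← hsum] at hg
  have hlt : r < Fintype.card V := by
    have : 0 < Fintype.card V := by omega
    obtain ⟨v⟩ := Fintype.card_pos_iff.1 this
    rw [← hreg v]; exact G.degree_lt_card_verts v
  simp only [Finset.mem_Icc] at ha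
  generalize Fintype.card V = n at *
  generalize ∑ v, f v = S at *
  clear hsum hgauss hc hf hreg
  obtain ⟨k, rfl⟩ : ∃ k, n = 4 * k + 2 := ⟨n / 4, by omega⟩
  obtain ⟨l, rfl⟩ : ∃ l, r = 4 * l + 2 := ⟨r / 4, by omega⟩
  have e1 : (2 * l + 1) * S = (2 * k + 1) * c := by linarith
  have e2 : S + a = (4 * k + 3) * (2 * k + 2) := by linarith
  have key : ¬ ∃ q : ℤ, (4 * l + 2 : ℤ) = (4 * k + 2) * q := by
    rintro ⟨q, hq⟩
    have : (0 : ℤ) < 4 * k + 2 := by positivity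
    rcases lt_or_ge 0 q with h | h
    · nlinarith
    · nlinarith
  have e1z : (2 * l + 1 : ℤ) * S = (2 * k + 1) * c := by exact_mod_cast e1
  have e2z : (S : ℤ) + a = (4 * k + 3) * (2 * k + 2) := by exact_mod_cast e2
  refine ⟨?_, ?_, ?_⟩
  · have p1 := congrArg Even e1
    have p2 := congrArg Even e2
    simp only [Nat.even_mul, Nat.even_add, eq_iff_iff] at p1 p2 hev
    simp +decide at p1 p2
    tauto
  · rintro rfl
    -- `r (n+3)/2 - c = r (a-1) / n`
    refine key ⟨(2 * l + 1) * (4 * k + 5) - c, ?_⟩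
    have : (S : ℤ) = (4 * k + 3) * (2 * k + 2) - 2 := by push_cast at e2z; linarith
    rw [this] at e1z
    linear_combination (-2) * e1z
  · rintro rfl
    refine key ⟨c - (2 * l + 1) * (4 * k + 5) + (4 * l + 2), ?_⟩
    have : (S : ℤ) = (4 * k + 3) * (2 * k + 2) - (4 * k + 2) := by push_cast at e2z; linarith
    rw [this] at e1z
    linear_combination (2) * e1z
end

section
/- Let G be an r-regular finite simple graph on n vertices, let a ∈ {1, ..., n}, and suppose there is a bijection f : V(G) → {1, ..., n+1} \ {a} such that the weight w(u) = Σ_{v ∈ N(u)} f(v) equals the same constant c for every vertex u. Then r·(n² + n + 2) ≤ 2nc ≤ r·(n² + 3n); equivalently, (nr+r)/2 + r/n ≤ c ≤ (nr+3r)/2. -/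
/-- Let `G` be an `r`-regular finite simple graph on `n` vertices, let
`a ∈ {1,...,n}`, and suppose there is a bijection `f : V(G) → {1,...,n+1} \ {a}` whose weight
`w(u) = ∑_{v ∈ N(u)} f v` equals the same constant `c` for every vertex `u`. Then
`r·(n² + n + 2) ≤ 2nc ≤ r·(n² + 3n)`, i.e. `(nr+r)/2 + r/n ≤ c ≤ (nr+3r)/2`. -/
theorem stmt7 {V : Type*} [Fintype V] [DecidableEq V]
    (G : SimpleGraph V) [DecidableRel G.Adj] (r a c : ℕ)
    (hreg : G.IsRegularOfDegree r)
    (ha : a ∈ Finset.Icc 1 (Fintype.card V))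
    (f : V → ℕ)
    (hbij : Set.BijOn f Set.univ ((Set.Icc 1 (Fintype.card V + 1)) \ {a}))
    (hw : ∀ u : V, ∑ v ∈ G.neighborFinset u, f v = c) :
    r * (Fintype.card V ^ 2 + Fintype.card V + 2) ≤ 2 * Fintype.card V * c ∧
    2 * Fintype.card V * c ≤ r * (Fintype.card V ^ 2 + 3 * Fintype.card V) := by
  classical
  have hS : ∑ v, f v + a = ∑ i ∈ Finset.Icc 1 (Fintype.card V + 1), i := by
    have himg : Finset.univ.image f = (Finset.Icc 1 (Fintype.card V + 1)).erase a := by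
      have h := hbij.image_eq
      ext x
      have hx := Set.ext_iff.mp h x
      simp at hx
      simp [hx]
      tauto
    have hinj : Set.InjOn f (Finset.univ : Finset V) := by
      simpa using hbij.injOn
    have h1 : ∑ i ∈ Finset.univ.image f, i = ∑ v, f v := Finset.sum_image hinj
    rw [← h1, himg]
    apply Finset.sum_erase_add (f := fun i => i)
    simp only [Finset.mem_Icc] at ha ⊢
    omega
  have hG : ∀ n : ℕ, 2 * ∑ i ∈ Finset.Icc 1 (n + 1), i = n ^ 2 + 3 * n + 2 := by
    intro n
    induction n with
    | zero => simp
    | succ k ih =>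
      rw [Finset.sum_Icc_succ_top (by omega), mul_add, ih]
      ring
  have hD : Fintype.card V * c = r * ∑ v, f v := by
    have h1 : ∑ u, ∑ v ∈ G.neighborFinset u, f v = Fintype.card V * c := by
      simp [hw]
    rw [← h1, Finset.sum_comm' (t' := Finset.univ) (s' := fun v => G.neighborFinset v)
      (by intro x y; simp [G.adj_comm]), Finset.mul_sum]
    refine Finset.sum_congr rfl fun v _ => ?_
    rw [Finset.sum_const, G.card_neighborFinset_eq_degree, hreg v, smul_eq_mul]
  have hN := hG (Fintype.card V)
  rw [← hS] at hN
  simp only [Finset.mem_Icc] at ha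
  have hE : 2 * Fintype.card V * c = r * (2 * ∑ v, f v) := by
    rw [mul_assoc, hD]; ring
  rw [hE]
  constructor <;> apply Nat.mul_le_mul_left <;> omega
end
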